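/- Let ω₁, ω₂ ∈ ℂ∖{0} with Im(ω₂/ω₁) > 0, Ω = {m₁ω₁ + m₂ω₂ : m₁, m₂ ∈ ℤ}, η₁ = 2ζ(ω₁/2; ω₁, ω₂). Let p₁, …, p_N ∈ ℂ be pairwise non-congruent modulo Ω, none congruent to 0 modulo Ω, let L₁, …, L_N ∈ ℂ, and let γ ∈ ℂ. Suppose H is holomorphic on ℂ ∖ ⋃_j (p_j + Ω) and satisfies: (a) H(z + ω₁) = H(z) and H(z + ω₂) = H(z) + γ for all z in the domain; (b) the function z ↦ H(z) − Σ_{j=1}^N L_j·ζ(z − p_j; ω₁, ω₂) extends to an entire function; (c) H(0) = 0. Then H(z) = Σ_{j=1}^N L_j·[ζ(z − p_j; ω₁, ω₂) − (η₁/ω₁)·z + ζ(p_j; ω₁, ω₂)] for all z in the domain, and γ = −(2πi/ω₁)·Σ_{j=1}^N L_j. -/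

import Mathlib

open Complex Filter Topology

/-- The period lattice `Ω = {m₁ω₁ + m₂ω₂ : m₁, m₂ ∈ ℤ}`. -/
def lattice (ω₁ ω₂ : ℂ) : Set ℂ :=
  {w | ∃ m₁ m₂ : ℤ, w = (m₁ : ℂ) * ω₁ + (m₂ : ℂ) * ω₂}

/-- The nonzero lattice points, as a subtype (index of summation). -/
abbrev latticeNZ (ω₁ ω₂ : ℂ) : Type :=
  {w : ℂ // w ∈ lattice ω₁ ω₂ ∧ w ≠ 0}

/-- Weierstrass ζ-function associated with periods `(ω₁, ω₂)`. -/
noncomputable def wZeta (ω₁ ω₂ z : ℂ) : ℂ :=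
  1 / z + ∑' w : latticeNZ ω₁ ω₂, (1 / (z - (w : ℂ)) + 1 / (w : ℂ) + z / (w : ℂ) ^ 2)

/-- Quasi-period constant `η₁ = 2ζ(ω₁/2)`. -/
noncomputable def eta1 (ω₁ ω₂ : ℂ) : ℂ := 2 * wZeta ω₁ ω₂ (ω₁ / 2)

/-- The pair `(ω₁, ω₂)` as a `PeriodPair`, when `ω₂ / ω₁` lies in the upper half plane. -/
def periodPairOfIm (ω₁ ω₂ : ℂ) (hτ : 0 < (ω₂ / ω₁).im) : PeriodPair where
  ω₁ := ω₁
  ω₂ := ω₂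
  indep := by
    have hω₁ : ω₁ ≠ 0 := by rintro rfl; simp at hτ
    refine LinearIndependent.pair_iff.mpr fun s t h ↦ ?_
    have h' : (s : ℂ) + t * (ω₂ / ω₁) = 0 := by
      simp only [real_smul] at h
      field_simp
      rw [h, mul_zero]
    have ht : t = 0 := by
      have := congrArg im h'
      simp only [add_im, ofReal_im, im_ofReal_mul, zero_add, zero_im, mul_eq_zero] at this
      exact this.resolve_right hτ.ne'
    exact ⟨by simpa [ht] using h', ht⟩

/-- The lattice point `q.2 * ω₁ + q.1 * ω₂`, so that `q.1` numbers the row parallel to `ω₁`. -/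
def latticePoint (ω₁ ω₂ : ℂ) (q : ℤ × ℤ) : ℂ := q.2 * ω₁ + q.1 * ω₂

/-- The general term of the Weierstrass zeta series. At `w = 0` it reduces to `1 / z`. -/
noncomputable def zetaTerm (z w : ℂ) : ℂ := 1 / (z - w) + 1 / w + z / w ^ 2

lemma latticePoint_mem_lattice (ω₁ ω₂ : ℂ) (q : ℤ × ℤ) :
    latticePoint ω₁ ω₂ q ∈ lattice ω₁ ω₂ := ⟨q.2, q.1, rfl⟩

lemma add_mem_lattice {ω₁ ω₂ z w : ℂ} (hz : z ∈ lattice ω₁ ω₂) (hw : w ∈ lattice ω₁ ω₂) :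
    z + w ∈ lattice ω₁ ω₂ := by
  obtain ⟨a, b, rfl⟩ := hz
  obtain ⟨c, d, rfl⟩ := hw
  exact ⟨a + c, b + d, by push_cast; ring⟩

lemma neg_mem_lattice {ω₁ ω₂ z : ℂ} (hz : z ∈ lattice ω₁ ω₂) : -z ∈ lattice ω₁ ω₂ := by
  obtain ⟨a, b, rfl⟩ := hz
  exact ⟨-a, -b, by push_cast; ring⟩

lemma left_mem_lattice (ω₁ ω₂ : ℂ) : ω₁ ∈ lattice ω₁ ω₂ := ⟨1, 0, by simp⟩

lemma right_mem_lattice (ω₁ ω₂ : ℂ) : ω₂ ∈ lattice ω₁ ω₂ := ⟨0, 1, by simp⟩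

lemma add_mem_lattice_iff {ω₁ ω₂ z w : ℂ} (hw : w ∈ lattice ω₁ ω₂) :
    z + w ∈ lattice ω₁ ω₂ ↔ z ∈ lattice ω₁ ω₂ :=
  ⟨fun h ↦ by simpa using add_mem_lattice h (neg_mem_lattice hw), fun h ↦ add_mem_lattice h hw⟩

lemma countable_lattice (ω₁ ω₂ : ℂ) : (lattice ω₁ ω₂).Countable :=
  (Set.countable_range (latticePoint ω₁ ω₂)).mono
    (by rintro _ ⟨m, n, rfl⟩; exact ⟨(n, m), rfl⟩)

section Series

variable {ω₁ ω₂ : ℂ}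

lemma latticeEquivProd_symm_swap (hτ : 0 < (ω₂ / ω₁).im) (q : ℤ × ℤ) :
    ((periodPairOfIm ω₁ ω₂ hτ).latticeEquivProd.symm q.swap : ℂ) = latticePoint ω₁ ω₂ q :=
  PeriodPair.latticeEquiv_symm_apply _ _

lemma latticePoint_injective (hτ : 0 < (ω₂ / ω₁).im) :
    Function.Injective (latticePoint ω₁ ω₂) := by
  intro q r h
  rw [← latticeEquivProd_symm_swap hτ, ← latticeEquivProd_symm_swap hτ] at h
  exact Prod.swap_injective ((LinearEquiv.injective _) (Subtype.ext h))

lemma summable_norm_latticePoint (hτ : 0 < (ω₂ / ω₁).im) :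
    Summable fun q : ℤ × ℤ ↦ ‖latticePoint ω₁ ω₂ q‖⁻¹ ^ 3 := by
  have h := ZLattice.summable_norm_pow_inv (periodPairOfIm ω₁ ω₂ hτ).lattice 3 (by simp)
  rw [← ((Equiv.prodComm ℤ ℤ).trans
    (periodPairOfIm ω₁ ω₂ hτ).latticeEquivProd.symm.toEquiv).summable_iff] at h
  refine h.congr fun q ↦ ?_
  rw [← latticeEquivProd_symm_swap hτ]
  rfl

lemma norm_zetaTerm_le {z w : ℂ} (h : 2 * ‖z‖ + 1 ≤ ‖w‖) :
    ‖zetaTerm z w‖ ≤ 2 * ‖z‖ ^ 2 * ‖w‖⁻¹ ^ 3 := by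
  have hz := norm_nonneg z
  have hw : 0 < ‖w‖ := by linarith
  have hsub : ‖w‖ / 2 ≤ ‖z - w‖ := by
    have := norm_sub_norm_le w z
    rw [norm_sub_rev] at this
    linarith
  have hsub0 : z - w ≠ 0 := norm_pos_iff.mp (by linarith)
  have hw0 : w ≠ 0 := norm_pos_iff.mp hw
  have : zetaTerm z w = z ^ 2 / (w ^ 2 * (z - w)) := by
    unfold zetaTerm
    field_simp
    ring
  rw [this, norm_div, norm_mul, norm_pow, norm_pow]
  calc ‖z‖ ^ 2 / (‖w‖ ^ 2 * ‖z - w‖) ≤ ‖z‖ ^ 2 / (‖w‖ ^ 2 * (‖w‖ / 2)) := by gcongr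
    _ = 2 * ‖z‖ ^ 2 * ‖w‖⁻¹ ^ 3 := by field_simp

lemma summable_zetaTerm (hτ : 0 < (ω₂ / ω₁).im) (z : ℂ) :
    Summable fun q ↦ zetaTerm z (latticePoint ω₁ ω₂ q) := by
  have hs := summable_norm_latticePoint hτ
  refine .of_norm_bounded_eventually (hs.mul_left (2 * ‖z‖ ^ 2)) ?_
  have hc : 0 < 2 * ‖z‖ + 1 := by positivity
  filter_upwards [hs.tendsto_cofinite_zero.eventually_lt_const
    (show 0 < (2 * ‖z‖ + 1)⁻¹ ^ 3 by positivity), eventually_cofinite_ne 0] with q hq hq0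
  have hne : latticePoint ω₁ ω₂ q ≠ 0 := fun h ↦
    hq0 (latticePoint_injective hτ (by rw [h]; simp [latticePoint]))
  have := lt_of_pow_lt_pow_left₀ 3 (by positivity) hq
  exact norm_zetaTerm_le ((inv_lt_inv₀ (norm_pos_iff.mpr hne) hc).mp this).le

lemma wZeta_eq_tsum (hτ : 0 < (ω₂ / ω₁).im) (z : ℂ) :
    wZeta ω₁ ω₂ z = ∑' q, zetaTerm z (latticePoint ω₁ ω₂ q) := by
  have hne {q : ℤ × ℤ} (hq : q ≠ 0) : latticePoint ω₁ ω₂ q ≠ 0 := fun h ↦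
    hq (latticePoint_injective hτ (by rw [h]; simp [latticePoint]))
  let e : {q : ℤ × ℤ // q ∉ ({0} : Finset (ℤ × ℤ))} ≃ latticeNZ ω₁ ω₂ :=
    Equiv.ofBijective
      (fun q ↦ ⟨latticePoint ω₁ ω₂ q, latticePoint_mem_lattice _ _ _, hne (by simpa using q.2)⟩)
      ⟨fun q r h ↦ Subtype.ext (latticePoint_injective hτ (congrArg Subtype.val h)),
        fun ⟨w, ⟨m, n, hw⟩, hw0⟩ ↦ ⟨⟨(n, m), by
          simp only [Finset.mem_singleton, Prod.mk_eq_zero]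
          rintro ⟨rfl, rfl⟩
          simp [hw] at hw0⟩, Subtype.ext hw.symm⟩⟩
  rw [← (summable_zetaTerm hτ z).sum_add_tsum_subtype_compl {0}, wZeta, ← e.tsum_eq]
  simp [latticePoint, zetaTerm, e]

lemma hasSum_wZeta (hτ : 0 < (ω₂ / ω₁).im) (z : ℂ) :
    HasSum (fun q ↦ zetaTerm z (latticePoint ω₁ ω₂ q)) (wZeta ω₁ ω₂ z) :=
  wZeta_eq_tsum hτ z ▸ (summable_zetaTerm hτ z).hasSum

lemma wZeta_neg (hτ : 0 < (ω₂ / ω₁).im) (z : ℂ) : wZeta ω₁ ω₂ (-z) = -wZeta ω₁ ω₂ z := by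
  rw [wZeta_eq_tsum hτ, wZeta_eq_tsum hτ, ← tsum_neg, ← (Equiv.neg (ℤ × ℤ)).tsum_eq]
  refine tsum_congr fun q ↦ ?_
  have : latticePoint ω₁ ω₂ (Equiv.neg (ℤ × ℤ) q) = -latticePoint ω₁ ω₂ q := by
    simp [latticePoint]
    ring
  rw [this]
  simp only [zetaTerm, show -z - -latticePoint ω₁ ω₂ q = -(z - latticePoint ω₁ ω₂ q) by ring,
    one_div, inv_neg, neg_sq, neg_div]
  ring

end Series

/-- If an unconditionally convergent double series has rows whose symmetric partial sums converge
to `r n`, then its sum is the sum of the `r n`. -/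
lemma HasSum.of_tendsto_rows {F : ℤ × ℤ → ℂ} {s : ℂ} {r : ℤ → ℂ} (hF : HasSum F s)
    (hr : ∀ n, Tendsto (fun N : ℕ ↦ ∑ m ∈ Finset.Icc (-N : ℤ) N, F (n, m)) atTop (𝓝 (r n))) :
    HasSum r s := by
  refine hF.prod_fiberwise fun n ↦ ?_
  have h := (hF.summable.prod_factor n).hasSum
  rwa [tendsto_nhds_unique (hr n) (h.comp Finset.tendsto_Icc_neg)]

lemma Complex.tendsto_sum_one_div_sub_intCast {x : ℂ} (hx : x ∈ integerComplement) :
    Tendsto (fun N : ℕ ↦ ∑ m ∈ Finset.Icc (-N : ℤ) N, 1 / (x - m)) atTop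
      (𝓝 (Real.pi * cot (Real.pi * x))) := by
  have h := (tendsto_logDeriv_euler_cot_sub hx).const_add (1 / x)
  rw [add_sub_cancel] at h
  refine h.congr fun N ↦ ?_
  induction N with
  | zero => simp
  | succ N ih =>
    rw [Finset.sum_range_succ, ← add_assoc, ih, Nat.cast_add_one,
      Finset.sum_Icc_succ_eq_add_endpoints]
    simp only [cotTerm]
    push_cast
    ring

lemma Complex.tendsto_cot_add_natCast_mul {τ : ℂ} (hτ : 0 < τ.im) (x : ℂ) :
    Tendsto (fun N : ℕ ↦ cot (Real.pi * (x + N * τ))) atTop (𝓝 (-I)) := by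
  have hq : Tendsto (fun N : ℕ ↦ exp (2 * Real.pi * I * (x + N * τ))) atTop (𝓝 0) := by
    have h := (tendsto_pow_atTop_nhds_zero_of_norm_lt_one
      (UpperHalfPlane.norm_exp_two_pi_I_lt_one ⟨τ, hτ⟩)).const_mul (exp (2 * Real.pi * I * x))
    rw [mul_zero] at h
    refine h.congr fun N ↦ ?_
    rw [← exp_nat_mul, ← exp_add]
    congr 1
    ring
  have h := (hq.add_const 1).div ((hq.const_sub 1).const_mul I) (by simp)
  simp only [zero_add, sub_zero, mul_one, one_div, inv_I] at h
  exact h.congr fun N ↦ (cot_pi_eq_exp_ratio _).symm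

lemma Complex.tendsto_cot_sub_natCast_mul {τ : ℂ} (hτ : 0 < τ.im) (x : ℂ) :
    Tendsto (fun N : ℕ ↦ cot (Real.pi * (x - N * τ))) atTop (𝓝 I) := by
  have h := (tendsto_cot_add_natCast_mul hτ (-x)).neg
  rw [neg_neg] at h
  refine h.congr fun N ↦ ?_
  rw [show (Real.pi : ℂ) * (x - N * τ) = -(Real.pi * (-x + N * τ)) by ring]
  simp [cot, div_neg]

/-- The symmetric row sum `∑ₘ 1 / (a - m ω)`. -/
noncomputable def rowSum (ω a : ℂ) : ℂ := Real.pi * cot (Real.pi * (a / ω)) / ω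

lemma rowSum_add_self {ω : ℂ} (hω : ω ≠ 0) (a : ℂ) : rowSum ω (a + ω) = rowSum ω a := by
  rw [rowSum, rowSum, add_div, div_self hω, mul_add, mul_one]
  simp [cot, sin_add_pi, cos_add_pi, neg_div_neg_eq]

lemma tendsto_rowSum {ω a : ℂ} (hω : ω ≠ 0) (ha : ∀ m : ℤ, a ≠ m * ω) :
    Tendsto (fun N : ℕ ↦ ∑ m ∈ Finset.Icc (-N : ℤ) N, 1 / (a - m * ω)) atTop
      (𝓝 (rowSum ω a)) := by
  have hx : a / ω ∈ integerComplement := by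
    rintro ⟨m, hm⟩
    exact ha m (by rw [hm]; field_simp)
  refine ((tendsto_sum_one_div_sub_intCast hx).div_const ω).congr fun N ↦ ?_
  rw [Finset.sum_div]
  refine Finset.sum_congr rfl fun m _ ↦ ?_
  rw [div_div, sub_mul, div_mul_cancel₀ _ hω]

section QuasiPeriods

variable {ω₁ ω₂ : ℂ}

lemma tendsto_sum_row (hω₁ : ω₁ ≠ 0) {z : ℂ} (hz : z ∉ lattice ω₁ ω₂) (n : ℤ) :
    Tendsto (fun N : ℕ ↦ ∑ m ∈ Finset.Icc (-N : ℤ) N, 1 / (z - latticePoint ω₁ ω₂ (n, m))) atTop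
      (𝓝 (rowSum ω₁ (z - n * ω₂))) := by
  refine (tendsto_rowSum hω₁ fun m hm ↦ hz ⟨m, n, ?_⟩).congr fun N ↦ ?_
  · linear_combination hm
  · refine Finset.sum_congr rfl fun m _ ↦ ?_
    simp only [latticePoint]
    ring

lemma wZeta_add_left_sub_eq (hω₁ : ω₁ ≠ 0) (hτ : 0 < (ω₂ / ω₁).im) {z z' : ℂ}
    (hz : z ∉ lattice ω₁ ω₂) (hz' : z' ∉ lattice ω₁ ω₂) :
    wZeta ω₁ ω₂ (z + ω₁) - wZeta ω₁ ω₂ z = wZeta ω₁ ω₂ (z' + ω₁) - wZeta ω₁ ω₂ z' := by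
  have hzl := (add_mem_lattice_iff (left_mem_lattice ω₁ ω₂)).not.mpr hz
  have hzl' := (add_mem_lattice_iff (left_mem_lattice ω₁ ω₂)).not.mpr hz'
  have hF := ((hasSum_wZeta hτ (z + ω₁)).sub (hasSum_wZeta hτ z)).sub
    ((hasSum_wZeta hτ (z' + ω₁)).sub (hasSum_wZeta hτ z'))
  have hr : HasSum (fun _ : ℤ ↦ (0 : ℂ)) _ := hF.of_tendsto_rows fun n ↦ by
    have h := ((tendsto_sum_row hω₁ hzl n).sub (tendsto_sum_row hω₁ hz n)).sub
      ((tendsto_sum_row hω₁ hzl' n).sub (tendsto_sum_row hω₁ hz' n))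
    rw [add_sub_right_comm, add_sub_right_comm, rowSum_add_self hω₁, rowSum_add_self hω₁,
      sub_self, sub_self, sub_self] at h
    refine h.congr fun N ↦ ?_
    simp only [← Finset.sum_sub_distrib, zetaTerm]
    refine Finset.sum_congr rfl fun m _ ↦ ?_
    ring
  exact sub_eq_zero.mp (hr.unique hasSum_zero)

/-- The Legendre relation, for the increments of `ζ` at an arbitrary point off the lattice. -/
lemma wZeta_legendre (hω₁ : ω₁ ≠ 0) (hτ : 0 < (ω₂ / ω₁).im) {z : ℂ}
    (hz : z ∉ lattice ω₁ ω₂) :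
    ω₁ * (wZeta ω₁ ω₂ (z + ω₂) - wZeta ω₁ ω₂ z) - ω₂ * (wZeta ω₁ ω₂ (z + ω₁) - wZeta ω₁ ω₂ z) =
      -(2 * Real.pi * I) := by
  have hz₁ := (add_mem_lattice_iff (left_mem_lattice ω₁ ω₂)).not.mpr hz
  have hz₂ := (add_mem_lattice_iff (right_mem_lattice ω₁ ω₂)).not.mpr hz
  have hF := (((hasSum_wZeta hτ (z + ω₂)).sub (hasSum_wZeta hτ z)).mul_left ω₁).sub
    (((hasSum_wZeta hτ (z + ω₁)).sub (hasSum_wZeta hτ z)).mul_left ω₂)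
  set k : ℤ → ℂ := fun n ↦ ω₁ * rowSum ω₁ (z + ω₂ - n * ω₂) with hk
  have hr := hF.of_tendsto_rows (r := fun n ↦ k n - k (n + 1)) fun n ↦ by
    have h := (((tendsto_sum_row hω₁ hz₂ n).sub (tendsto_sum_row hω₁ hz n)).const_mul ω₁).sub
      (((tendsto_sum_row hω₁ hz₁ n).sub (tendsto_sum_row hω₁ hz n)).const_mul ω₂)
    rw [add_sub_right_comm z ω₁, rowSum_add_self hω₁, sub_self, mul_zero, sub_zero] at h
    have hkn : k n - k (n + 1) =
        ω₁ * (rowSum ω₁ (z + ω₂ - n * ω₂) - rowSum ω₁ (z - n * ω₂)) := by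
      simp only [hk]
      rw [mul_sub, show z + ω₂ - ((n + 1 : ℤ) : ℂ) * ω₂ = z - n * ω₂ by push_cast; ring]
    rw [hkn]
    refine h.congr fun N ↦ ?_
    simp only [← Finset.sum_sub_distrib, Finset.mul_sum, zetaTerm]
    refine Finset.sum_congr rfl fun m _ ↦ ?_
    ring
  have hlim := hr.comp Finset.tendsto_Ico_neg
  simp only [Function.comp_def, Finset.sum_Ico_int_sub] at hlim
  refine tendsto_nhds_unique hlim ?_
  have h := ((tendsto_cot_add_natCast_mul hτ ((z + ω₂) / ω₁)).sub
    (tendsto_cot_sub_natCast_mul hτ ((z + ω₂) / ω₁))).const_mul (Real.pi : ℂ)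
  rw [show (Real.pi : ℂ) * (-I - I) = -(2 * Real.pi * I) by ring] at h
  refine h.congr fun N ↦ ?_
  have hrow (a : ℂ) : ω₁ * rowSum ω₁ a = Real.pi * cot (Real.pi * (a / ω₁)) := by
    rw [rowSum]
    field_simp
  simp only [hk, hrow]
  rw [mul_sub]
  congr 5 <;> push_cast <;> ring

lemma neg_half_left_notMem_lattice (hτ : 0 < (ω₂ / ω₁).im) : -(ω₁ / 2) ∉ lattice ω₁ ω₂ := by
  intro h
  obtain ⟨m, n, h⟩ := neg_mem_lattice h
  exact (periodPairOfIm ω₁ ω₂ hτ).ω₁_div_two_notMem_lattice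
    (PeriodPair.mem_lattice.mpr ⟨m, n, by rw [neg_neg] at h; exact h.symm⟩)

lemma wZeta_add_left (hω₁ : ω₁ ≠ 0) (hτ : 0 < (ω₂ / ω₁).im) {z : ℂ}
    (hz : z ∉ lattice ω₁ ω₂) : wZeta ω₁ ω₂ (z + ω₁) = wZeta ω₁ ω₂ z + eta1 ω₁ ω₂ := by
  have h := wZeta_add_left_sub_eq hω₁ hτ hz (neg_half_left_notMem_lattice hτ)
  rw [show -(ω₁ / 2) + ω₁ = ω₁ / 2 by ring, wZeta_neg hτ] at h
  rw [eta1]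
  linear_combination h

lemma wZeta_add_right (hω₁ : ω₁ ≠ 0) (hτ : 0 < (ω₂ / ω₁).im) {z : ℂ}
    (hz : z ∉ lattice ω₁ ω₂) :
    wZeta ω₁ ω₂ (z + ω₂) =
      wZeta ω₁ ω₂ z + (ω₂ * eta1 ω₁ ω₂ - 2 * Real.pi * I) / ω₁ := by
  have h := wZeta_legendre hω₁ hτ hz
  rw [wZeta_add_left hω₁ hτ hz] at h
  field_simp
  linear_combination h

/-- An entire function whose increments along both periods are constant is affine. -/
lemma exists_eq_add_mul_of_increments {S : ℂ → ℂ} (hS : Differentiable ℂ S)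
    (hτ : 0 < (ω₂ / ω₁).im) {c₁ c₂ : ℂ} (h₁ : ∀ z, S (z + ω₁) = S z + c₁)
    (h₂ : ∀ z, S (z + ω₂) = S z + c₂) : ∃ a, ∀ z, S z = S 0 + a * z := by
  have hper {w c : ℂ} (h : ∀ z, S (z + w) = S z + c) : Function.Periodic (deriv S) w := fun z ↦ by
    rw [← deriv_comp_add_const, funext h, deriv_add_const]
  have hper' (z w : ℂ) (hw : w ∈ (periodPairOfIm ω₁ ω₂ hτ).lattice) :
      deriv S (z + w) = deriv S z := by
    obtain ⟨m, n, rfl⟩ := PeriodPair.mem_lattice.mp hw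
    exact (((hper h₁).int_mul m).add_period ((hper h₂).int_mul n)) z
  have hdiff : Differentiable ℂ (deriv S) := hS.deriv
  have hbdd := (IsZLattice.isCompact_range_of_periodic _ _ hdiff.continuous hper').isBounded
  refine ⟨deriv S 0, fun z ↦ ?_⟩
  have hT : Differentiable ℂ fun z ↦ S z - deriv S 0 * z := by fun_prop
  have h := is_const_of_deriv_eq_zero hT (fun w ↦ by
    rw [deriv_fun_sub hS.differentiableAt (by fun_prop), deriv_const_mul_id',
      hdiff.apply_eq_apply_of_bounded hbdd w 0, sub_self]) z 0
  simp only [mul_zero, sub_zero] at h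
  linear_combination h

end QuasiPeriods

/-- the analytic core of the Loewner–Komatu equation. A function `H` that is
holomorphic off the translated lattices, `ω₁`-periodic, quasi-periodic in `ω₂` with
increment `γ`, differing from `Σⱼ Lⱼ ζ(z − pⱼ)` by an entire function, and normalized by
`H(0) = 0`, equals `Σⱼ Lⱼ [ζ(z − pⱼ) − (η₁/ω₁)z + ζ(pⱼ)]`, and `γ = −(2πi/ω₁) Σⱼ Lⱼ`. -/
theorem loewner_komatu_core (ω₁ ω₂ : ℂ) (hω₁ : ω₁ ≠ 0) (hω₂ : ω₂ ≠ 0)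
    (hτ : 0 < (ω₂ / ω₁).im) (N : ℕ) (p : Fin N → ℂ)
    (hpp : ∀ i j, i ≠ j → p i - p j ∉ lattice ω₁ ω₂)
    (hp0 : ∀ j, p j ∉ lattice ω₁ ω₂)
    (L : Fin N → ℂ) (γ : ℂ) (H : ℂ → ℂ)
    (hholo : ∀ z : ℂ, (∀ j, z - p j ∉ lattice ω₁ ω₂) → DifferentiableAt ℂ H z)
    (hper1 : ∀ z : ℂ, (∀ j, z - p j ∉ lattice ω₁ ω₂) → H (z + ω₁) = H z)
    (hper2 : ∀ z : ℂ, (∀ j, z - p j ∉ lattice ω₁ ω₂) → H (z + ω₂) = H z + γ)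
    (hext : ∃ S : ℂ → ℂ, Differentiable ℂ S ∧
      ∀ z : ℂ, (∀ j, z - p j ∉ lattice ω₁ ω₂) →
        S z = H z - ∑ j, L j * wZeta ω₁ ω₂ (z - p j))
    (h0 : H 0 = 0) :
    (∀ z : ℂ, (∀ j, z - p j ∉ lattice ω₁ ω₂) →
      H z = ∑ j, L j *
        (wZeta ω₁ ω₂ (z - p j) - eta1 ω₁ ω₂ / ω₁ * z + wZeta ω₁ ω₂ (p j))) ∧
    γ = -(2 * (Real.pi : ℂ) * Complex.I / ω₁) * ∑ j, L j := by
  obtain ⟨S, hS, hSH⟩ := hext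
  have hdense : Dense {z : ℂ | ∀ j, z - p j ∉ lattice ω₁ ω₂} := by
    have hc : (⋃ j, (fun z ↦ z - p j) ⁻¹' lattice ω₁ ω₂).Countable :=
      Set.countable_iUnion fun j ↦
        (countable_lattice ω₁ ω₂).preimage_of_injOn (sub_left_injective.injOn)
    convert hc.dense_compl ℂ using 1
    ext z
    simp
  have hshift {w z : ℂ} (hw : w ∈ lattice ω₁ ω₂) (hz : ∀ j, z - p j ∉ lattice ω₁ ω₂) (j : Fin N) :
      z + w - p j ∉ lattice ω₁ ω₂ := by
    rw [add_sub_right_comm, add_mem_lattice_iff hw]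
    exact hz j
  have hinc {w c : ℂ} (h : ∀ z : ℂ, (∀ j, z - p j ∉ lattice ω₁ ω₂) → S (z + w) = S z + c) (z : ℂ) :
      S (z + w) = S z + c :=
    congrFun (Continuous.ext_on hdense (hS.continuous.comp (continuous_add_const w))
      (hS.continuous.add_const c) h) z
  have hS₁ := hinc (w := ω₁) (c := -(eta1 ω₁ ω₂ * ∑ j, L j)) fun z hz ↦ by
    rw [hSH z hz, hSH _ (hshift (left_mem_lattice _ _) hz), hper1 z hz]
    simp only [add_sub_right_comm, wZeta_add_left hω₁ hτ (hz _), mul_add, Finset.sum_add_distrib,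
      ← Finset.sum_mul]
    ring
  have hS₂ := hinc (w := ω₂)
      (c := γ - (ω₂ * eta1 ω₁ ω₂ - 2 * Real.pi * I) / ω₁ * ∑ j, L j) fun z hz ↦ by
    rw [hSH z hz, hSH _ (hshift (right_mem_lattice _ _) hz), hper2 z hz]
    simp only [add_sub_right_comm z, wZeta_add_right hω₁ hτ (hz _), mul_add,
      Finset.sum_add_distrib, ← Finset.sum_mul]
    ring
  obtain ⟨a, ha⟩ := exists_eq_add_mul_of_increments hS hτ hS₁ hS₂
  have ha₁ : a = -(eta1 ω₁ ω₂ / ω₁ * ∑ j, L j) := by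
    have h := hS₁ 0
    rw [zero_add, ha ω₁] at h
    field_simp
    linear_combination h
  have hS0 : S 0 = ∑ j, L j * wZeta ω₁ ω₂ (p j) := by
    rw [hSH 0 fun j h ↦ hp0 j (by simpa using neg_mem_lattice h), h0]
    simp [wZeta_neg hτ]
  constructor
  · intro z hz
    have h := hSH z hz
    rw [ha z, ha₁, hS0] at h
    simp only [mul_add, mul_sub, Finset.sum_add_distrib, Finset.sum_sub_distrib, ← Finset.sum_mul]
    linear_combination -h
  · have h := hS₂ 0
    rw [zero_add, ha ω₂, ha₁] at h
    linear_combination -h
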